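/- Let X be a set and let C be an algebra of real-valued functions on X (a vector space closed under pointwise multiplication). Then for every integer p ≥ 1, C^p = span{ ḡ · δ_{p-1} Alt_p(f_1⊗⋯⊗f_p) : g ∈ C⊕ℝ, f_1,…,f_p ∈ C }, where ḡ(x_0,…,x_p) := (1/(p+1)) Σ_{i=0}^p g(x_i). -/

import Mathlib

noncomputable section

/-- The antisymmetrizer: `Alt_p(F)(x_1,…,x_p) = (1/p!) Σ_{σ ∈ S_p} sgn(σ) F(x_{σ(1)},…,x_{σ(p)})`. -/
def altP {X : Type*} {p : ℕ} (F : (Fin p → X) → ℝ) : (Fin p → X) → ℝ :=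
  fun x => (Nat.factorial p : ℝ)⁻¹ *
    ∑ σ : Equiv.Perm (Fin p), ((Equiv.Perm.sign σ : ℤ) : ℝ) * F (x ∘ σ)

/-- The Kolmogorov–Alexander–Spanier coboundary operator:
`δF(x_0, …, x_p) = Σ_{i=0}^p (-1)^i F(x_0, …, x̂_i, …, x_p)`. -/
def kasDelta {X : Type*} {p : ℕ} (F : (Fin p → X) → ℝ) : (Fin (p + 1) → X) → ℝ :=
  fun x => ∑ i : Fin (p + 1), (-1 : ℝ) ^ (i : ℕ) * F (x ∘ i.succAbove)

/-- The tensor product of functions: `(f_1 ⊗ … ⊗ f_p)(x_1,…,x_p) = f_1(x_1)⋯f_p(x_p)`. -/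
def tens {X : Type*} {p : ℕ} (f : Fin p → X → ℝ) : (Fin p → X) → ℝ :=
  fun x => ∏ i, f i (x i)

/-- `C ⊕ ℝ`: the space of functions in `C` plus real constants. -/
def CplusR {X : Type*} (C : Submodule ℝ (X → ℝ)) : Submodule ℝ (X → ℝ) :=
  C ⊔ Submodule.span ℝ {fun _ => (1 : ℝ)}

/-- The spaces of elementary `p`-functions: `C^0 := C` (viewed as functions of one variable)
and, for `p ≥ 1`, `C^p := span{Alt_{p+1}(f_0⊗f_1⊗⋯⊗f_p) : f_0 ∈ C⊕ℝ, f_1,…,f_p ∈ C}`. -/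
def elemFns {X : Type*} (C : Submodule ℝ (X → ℝ)) :
    (p : ℕ) → Submodule ℝ ((Fin (p + 1) → X) → ℝ)
  | 0 => Submodule.map (LinearMap.funLeft ℝ ℝ (fun x : Fin 1 → X => x 0)) C
  | p + 1 => Submodule.span ℝ
      {F | ∃ f : Fin (p + 2) → X → ℝ,
        f 0 ∈ CplusR C ∧ (∀ i : Fin (p + 1), f i.succ ∈ C) ∧ F = altP (tens f)}

/-- `ḡ(x_0,…,x_{n-1}) := (1/n) Σ_{i=0}^{n-1} g(x_i)`, the symmetrized extension of `g` to
`n`-tuples. -/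
def gbar {X : Type*} (n : ℕ) (g : X → ℝ) : (Fin n → X) → ℝ :=
  fun x => (n : ℝ)⁻¹ * ∑ i, g (x i)

/-- Multiplying a determinant by `∑ i, g i` amounts to scaling its columns entrywise by `g`,
one at a time. -/
theorem Matrix.sum_mul_det_eq_sum_det_updateCol {n R : Type*} [Fintype n] [DecidableEq n]
    [CommRing R] (g : n → R) (M : Matrix n n R) :
    (∑ i, g i) * M.det = ∑ k, (M.updateCol k fun i => g i * M i k).det := by
  have key (σ : Equiv.Perm n) (k : n) :
      ∏ i, M.updateCol k (fun i => g i * M i k) (σ i) i = g (σ k) * ∏ i, M (σ i) i := by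
    rw [← Finset.mul_prod_erase _ _ (Finset.mem_univ k),
      ← Finset.mul_prod_erase _ (fun i => M (σ i) i) (Finset.mem_univ k),
      Matrix.updateCol_self, mul_assoc]
    congr 2
    refine Finset.prod_congr rfl fun i hi => ?_
    rw [Matrix.updateCol_ne (Finset.ne_of_mem_erase hi)]
  simp only [Matrix.det_apply', key]
  rw [Finset.sum_comm, Finset.mul_sum]
  refine Finset.sum_congr rfl fun σ _ => ?_
  rw [← Equiv.sum_comp σ g, Finset.sum_mul]
  exact Finset.sum_congr rfl fun k _ => by ring

theorem altP_tens_apply {X : Type*} {p : ℕ} (f : Fin p → X → ℝ) (x : Fin p → X) :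
    altP (tens f) x = (p.factorial : ℝ)⁻¹ * (Matrix.of fun i j => f j (x i)).det := by
  simp [altP, tens, Matrix.det_apply']

theorem kasDelta_altP_tens {X : Type*} {p : ℕ} (f : Fin p → X → ℝ) :
    kasDelta (altP (tens f)) =
      ((p + 1 : ℕ) : ℝ) • altP (tens (Fin.cons 1 f : Fin (p + 1) → X → ℝ)) := by
  ext x
  have hp : ((p + 1 : ℕ) : ℝ) ≠ 0 := by positivity
  simp only [kasDelta, Pi.smul_apply, smul_eq_mul, altP_tens_apply]
  rw [Nat.factorial_succ, Nat.cast_mul, mul_inv, mul_assoc, mul_inv_cancel_left₀ hp,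
    Matrix.det_succ_column_zero, Finset.mul_sum]
  refine Finset.sum_congr rfl fun i _ => ?_
  simp only [Matrix.of_apply, Fin.cons_zero, Pi.one_apply, mul_one]
  rw [mul_left_comm]
  rfl

theorem gbar_mul_altP_tens {X : Type*} {p : ℕ} (g : X → ℝ) (f : Fin p → X → ℝ) :
    gbar p g * altP (tens f) =
      (p : ℝ)⁻¹ • ∑ k, altP (tens (Function.update f k (g * f k))) := by
  ext x
  simp only [Pi.mul_apply, gbar, Pi.smul_apply, Finset.sum_apply, smul_eq_mul, altP_tens_apply]
  rw [← Finset.mul_sum, mul_assoc, mul_left_comm (∑ i, g (x i)),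
    Matrix.sum_mul_det_eq_sum_det_updateCol (fun i => g (x i))]
  congr 2
  refine Finset.sum_congr rfl fun k _ => congrArg Matrix.det ?_
  ext i j
  obtain rfl | h := eq_or_ne j k <;> simp [*]

theorem gbar_mul_kasDelta_altP_tens {X : Type*} {p : ℕ} (g : X → ℝ) (f : Fin p → X → ℝ) :
    gbar (p + 1) g * kasDelta (altP (tens f)) =
      altP (tens (Fin.cons g f : Fin (p + 1) → X → ℝ)) +
        ∑ k, altP (tens (Fin.cons 1 (Function.update f k (g * f k)) :
          Fin (p + 1) → X → ℝ)) := by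
  have hp : ((p + 1 : ℕ) : ℝ) ≠ 0 := by positivity
  rw [kasDelta_altP_tens, mul_smul_comm, gbar_mul_altP_tens, smul_inv_smul₀ hp,
    Fin.sum_univ_succ]
  simp [Fin.cons_update]

theorem gbar_one {X : Type*} (n : ℕ) : gbar (X := X) (n + 1) 1 = 1 := by
  ext x
  simp [gbar, inv_mul_cancel₀ (show (n : ℝ) + 1 ≠ 0 by positivity)]

theorem one_mem_CplusR {X : Type*} (C : Submodule ℝ (X → ℝ)) : 1 ∈ CplusR C :=
  Submodule.mem_sup_right (Submodule.mem_span_singleton_self _)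

theorem mul_mem_of_mem_CplusR {X : Type*} {C : Submodule ℝ (X → ℝ)}
    (hmul : ∀ f g : X → ℝ, f ∈ C → g ∈ C → f * g ∈ C) {g f : X → ℝ}
    (hg : g ∈ CplusR C) (hf : f ∈ C) : g * f ∈ C := by
  obtain ⟨a, ha, b, hb, rfl⟩ := Submodule.mem_sup.1 hg
  obtain ⟨c, rfl⟩ := Submodule.mem_span_singleton.1 hb
  rw [add_mul]
  refine C.add_mem (hmul a f ha hf) ?_
  convert C.smul_mem c hf using 1
  ext x
  simp

theorem update_mul_mem {X : Type*} {C : Submodule ℝ (X → ℝ)}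
    (hmul : ∀ f g : X → ℝ, f ∈ C → g ∈ C → f * g ∈ C) {p : ℕ} {g : X → ℝ}
    {f : Fin p → X → ℝ} (hg : g ∈ CplusR C) (hf : ∀ i, f i ∈ C) (k i : Fin p) :
    Function.update f k (g * f k) i ∈ C := by
  obtain rfl | h := eq_or_ne i k
  · simpa using mul_mem_of_mem_CplusR hmul hg (hf i)
  · simpa [h] using hf i

/-- If `C` is an algebra of real-valued functions on `X`, then for every `p ≥ 1`,
`C^p = span{ ḡ ⬝ δ_{p-1} Alt_p(f_1⊗⋯⊗f_p) : g ∈ C⊕ℝ, f_1,…,f_p ∈ C }`. -/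
theorem elemFns_eq_span_gbar_kasDelta {X : Type*} (C : Submodule ℝ (X → ℝ))
    (hmul : ∀ f g : X → ℝ, f ∈ C → g ∈ C → f * g ∈ C) (p : ℕ) :
    elemFns C (p + 1) = Submodule.span ℝ
      {F | ∃ (g : X → ℝ) (f : Fin (p + 1) → X → ℝ),
        g ∈ CplusR C ∧ (∀ i, f i ∈ C) ∧
          F = gbar (p + 2) g * kasDelta (altP (tens f))} := by
  apply le_antisymm
  · refine Submodule.span_le.2 ?_
    rintro _ ⟨f, hf0, hf, rfl⟩
    rw [← Fin.cons_self_tail f, SetLike.mem_coe,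
      eq_sub_of_add_eq (gbar_mul_kasDelta_altP_tens (f 0) (Fin.tail f)).symm]
    refine Submodule.sub_mem _ (Submodule.subset_span ⟨_, _, hf0, hf, rfl⟩)
      (Submodule.sum_mem _ fun k _ => ?_)
    have hp : ((p + 1 + 1 : ℕ) : ℝ) ≠ 0 := by positivity
    rw [← inv_smul_smul₀ hp (altP _), ← kasDelta_altP_tens]
    refine Submodule.smul_mem _ _ (Submodule.subset_span
      ⟨1, _, one_mem_CplusR C, update_mul_mem hmul hf0 hf k, ?_⟩)
    rw [gbar_one, one_mul]
    rfl
  · refine Submodule.span_le.2 ?_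
    rintro _ ⟨g, f, hg, hf, rfl⟩
    rw [SetLike.mem_coe, gbar_mul_kasDelta_altP_tens]
    exact Submodule.add_mem _ (Submodule.subset_span ⟨_, hg, hf, rfl⟩)
      (Submodule.sum_mem _ fun k _ => Submodule.subset_span
        ⟨_, one_mem_CplusR C, update_mul_mem hmul hg hf k, rfl⟩)
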